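/- Let q be a nonzero real number and let A be a unital ℝ-algebra equipped with a star-ring structure in which star is ℝ-linear. Suppose K, L ∈ A satisfy star K = K, L·(star L) + q²·K² = 1, (star L)·L + K² = 1, and L·K = q·K·L. Then the 2×2 matrix x = [[q·K, L], [star L, −K]] over A satisfies xᴴ = x (where ᴴ is transpose combined with entrywise star) and x² = 1. -/

import Mathlib

open Matrix

/-- For quantum sphere generators `K, L`, the matrix `x = [[qK, L],[L*, -K]]`
is self-adjoint and squares to the identity. -/
theorem quantum_sphere_involution
    (q : ℝ) (hq : q ≠ 0)
    (A : Type*) [Ring A] [Algebra ℝ A] [StarRing A] [StarModule ℝ A]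
    (K L : A)
    (hK : star K = K)
    (h1 : L * star L + (q ^ 2) • (K * K) = 1)
    (h2 : star L * L + K * K = 1)
    (h3 : L * K = q • (K * L)) :
    (!![q • K, L; star L, -K] : Matrix (Fin 2) (Fin 2) A)ᴴ = !![q • K, L; star L, -K] ∧
    (!![q • K, L; star L, -K] : Matrix (Fin 2) (Fin 2) A) * !![q • K, L; star L, -K] = 1 := by
  have h4 : K * star L = q • (star L * K) := by
    simpa [hK] using congrArg star h3
  constructor
  · ext i j
    fin_cases i <;> fin_cases j <;> simp [hK]
  · rw [Matrix.mul_fin_two, Matrix.one_fin_two]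
    have h5 : q • q • (K * K) + L * star L = 1 := by
      rw [smul_smul, ← pow_two, add_comm, h1]
    simp [h2, h3, h4, h5]
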